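/- Let (Ω, 𝒜, P) be a probability space, D ∈ 𝒜 with P(D) = ε where 0 < ε < 1, and let (ε_p)_{p∈ℕ} be a strictly decreasing sequence with ε ≥ ε_1 > ε_2 > … > 0. For each p define the measure μ_p = (ε_p/ε) • P.restrict D + ((1−ε_p)/(1−ε)) • P.restrict Dᶜ, and for a P-integrable u : Ω → ℝ set e_p = |∫ u dμ_p − (1/(1−ε))·∫_{Ω∖D} u dP|. If (1/ε)·∫_D u dP ≠ (1/(1−ε))·∫_{Ω∖D} u dP, then for every p the ratio of successive errors equals e_{p+1}/e_p = ε_{p+1}/ε_p, and this ratio is strictly less than 1; hence ∫ u dμ_p converges to (1/(1−ε))·∫_{Ω∖D} u dP at a Q-linear rate. -/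

import Mathlib

open MeasureTheory

/-- Reweighting `D` to mass `δ` moves the integral away from the mean over `Dᶜ` by exactly `δ` times
the difference of the means over `D` and `Dᶜ`. -/
lemma integral_reweighted_sub_compl_mean
    {Ω : Type*} [MeasurableSpace Ω] {P : Measure Ω} {D : Set Ω} {ε δ : ℝ}
    (hε0 : 0 < ε) (hε1 : ε < 1) (hδ0 : 0 ≤ δ) (hδ1 : δ ≤ 1)
    {u : Ω → ℝ} (hu : Integrable u P) :
    (∫ ω, u ω ∂(ENNReal.ofReal (δ / ε) • P.restrict D
          + ENNReal.ofReal ((1 - δ) / (1 - ε)) • P.restrict Dᶜ))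
        - (1 / (1 - ε)) * ∫ ω in Dᶜ, u ω ∂P
      = δ * ((1 / ε) * (∫ ω in D, u ω ∂P) - (1 / (1 - ε)) * ∫ ω in Dᶜ, u ω ∂P) := by
  have hδε : 0 ≤ δ / ε := by positivity
  have hδε' : 0 ≤ (1 - δ) / (1 - ε) := div_nonneg (by linarith) (by linarith)
  rw [integral_add_measure (hu.restrict.smul_measure ENNReal.ofReal_ne_top)
      (hu.restrict.smul_measure ENNReal.ofReal_ne_top),
    integral_smul_measure, integral_smul_measure,
    ENNReal.toReal_ofReal hδε, ENNReal.toReal_ofReal hδε', smul_eq_mul, smul_eq_mul]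
  ring

/-- Q-linear convergence rate: with a strictly decreasing sequence
`ε ≥ ε_0 > ε_1 > … > 0`, measures
`μ_p = (ε_p/ε) • P.restrict D + ((1−ε_p)/(1−ε)) • P.restrict Dᶜ`, and errors
`e_p = |∫ u dμ_p − (1/(1−ε))·∫_{Ω∖D} u dP|`, if
`(1/ε)·∫_D u dP ≠ (1/(1−ε))·∫_{Ω∖D} u dP` then `e_{p+1}/e_p = ε_{p+1}/ε_p < 1`
for every `p`, i.e. the convergence is Q-linear. -/
theorem tilted_measure_error_qlinear_rate
    {Ω : Type*} [MeasurableSpace Ω] (P : Measure Ω) [IsProbabilityMeasure P]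
    (D : Set Ω) (hD : MeasurableSet D)
    (ε : ℝ) (hε0 : 0 < ε) (hε1 : ε < 1) (hPD : P D = ENNReal.ofReal ε)
    (εp : ℕ → ℝ) (hanti : StrictAnti εp) (hεp0 : ∀ p, 0 < εp p)
    (hεpε : εp 0 ≤ ε)
    (u : Ω → ℝ) (hu : Integrable u P)
    (hne : (1 / ε) * (∫ ω in D, u ω ∂P)
        ≠ (1 / (1 - ε)) * ∫ ω in Dᶜ, u ω ∂P) :
    ∀ p : ℕ,
      (|(∫ ω, u ω ∂(ENNReal.ofReal (εp (p + 1) / ε) • P.restrict D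
            + ENNReal.ofReal ((1 - εp (p + 1)) / (1 - ε)) • P.restrict Dᶜ))
          - (1 / (1 - ε)) * ∫ ω in Dᶜ, u ω ∂P|)
        / (|(∫ ω, u ω ∂(ENNReal.ofReal (εp p / ε) • P.restrict D
            + ENNReal.ofReal ((1 - εp p) / (1 - ε)) • P.restrict Dᶜ))
          - (1 / (1 - ε)) * ∫ ω in Dᶜ, u ω ∂P|)
      = εp (p + 1) / εp p
      ∧ εp (p + 1) / εp p < 1 := by
  intro p
  have hle : ∀ q, εp q ≤ 1 := fun q =>
    ((hanti.antitone (Nat.zero_le q)).trans hεpε).trans hε1.le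
  refine ⟨?_, (div_lt_one (hεp0 p)).2 (hanti p.lt_succ_self)⟩
  rw [integral_reweighted_sub_compl_mean hε0 hε1 (hεp0 _).le (hle _) hu,
    integral_reweighted_sub_compl_mean hε0 hε1 (hεp0 _).le (hle _) hu,
    abs_mul, abs_mul, abs_of_pos (hεp0 _), abs_of_pos (hεp0 _)]
  exact mul_div_mul_right _ _ (abs_ne_zero.2 (sub_ne_zero.2 hne))
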